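/- Let Y be an affine scheme, let f : X → Y be a morphism of schemes, and let {U_α} be an affine open covering of X. Then f is semi-separated if and only if for every pair of indices α, β the intersection U_α ∩ U_β is an affine open subset of X. In particular, a scheme X is semi-separated (i.e., the canonical morphism X → Spec ℤ is semi-separated) if and only if the pairwise intersections of the members of some (equivalently, any) affine open cover of X are affine. -/

import Mathlib

/-!
STATEMENT 10: Let `Y` be an affine scheme, `f : X ⟶ Y` a morphism and `{U_α}` an affine
open covering of `X`. Then `f` is semi-separated if and only if all the pairwise
intersections `U_α ∩ U_β` are affine. In particular, a scheme `X` is semi-separated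
(i.e. the canonical morphism to the terminal scheme `Spec ℤ` is semi-separated) if and
only if the pairwise intersections of the members of an affine open cover of `X` are
affine.
-/

open CategoryTheory AlgebraicGeometry Limits

universe u

/-- A morphism of schemes is semi-separated if its diagonal morphism is affine. -/
def IsSemiSeparated {X Y : Scheme.{u}} (f : X ⟶ Y) : Prop :=
  IsAffineHom (pullback.diagonal f)

/-- A scheme is semi-separated if its canonical morphism to the terminal scheme
(`Spec ℤ`) is semi-separated. -/
def IsSemiSeparatedScheme (X : Scheme.{u}) : Prop :=
  IsSemiSeparated (terminal.from X)

/-- For affine `Y`, the diagonal of `f : X ⟶ Y` is affine as soon as the members of some affine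
open cover of `X` have affine pairwise intersections. -/
theorem isAffineHom_diagonal_of_isOpenCover
    {X Y : Scheme.{u}} [IsAffine Y] (f : X ⟶ Y) {ι : Type*} (U : ι → X.Opens)
    (hcov : TopologicalSpace.IsOpenCover U) (hU : ∀ i, IsAffineOpen (U i))
    (hinf : ∀ i j, IsAffineOpen (U i ⊓ U j)) :
    IsAffineHom (pullback.diagonal f) := by
  let Q : AffineTargetMorphismProperty.{u} := fun X _ _ _ ↦ IsAffine X
  have : HasAffineProperty @IsAffineHom Q := instHasAffinePropertyIsAffineHomIsAffine
  have : Q.IsLocal := HasAffineProperty.isLocal_affineProperty @IsAffineHom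
  suffices Q.diagonal f from (HasAffineProperty.diagonal_iff @IsAffineHom).mp this
  have : ∀ i, IsAffine ((X.openCoverOfIsOpenCover U hcov).X i) := hU
  refine AffineTargetMorphismProperty.diagonal_of_openCover_source f
    (X.openCoverOfIsOpenCover U hcov) fun i j ↦ ?_
  change IsAffine (pullback (U i).ι (U j).ι)
  have : IsAffine (U i ⊓ U j).toScheme := hinf i j
  exact .of_isIso (isPullback_opens_inf (U i) (U j)).isoPullback.inv

theorem isSemiSeparated_iff_of_isOpenCover
    {X Y : Scheme.{u}} [IsAffine Y] (f : X ⟶ Y) {ι : Type*} (U : ι → X.Opens)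
    (hcov : TopologicalSpace.IsOpenCover U) (hU : ∀ i, IsAffineOpen (U i)) :
    IsSemiSeparated f ↔ ∀ i j, IsAffineOpen (U i ⊓ U j) :=
  ⟨fun h i j ↦ isAffineHom_diagonal_iff.mp h ⊤ (isAffineOpen_top Y) (U i) le_top (U j) le_top
    (hU i) (hU j), isAffineHom_diagonal_of_isOpenCover f U hcov hU⟩

theorem isSemiSeparated_iff_affine_intersections
    {X Y : Scheme.{u}} [IsAffine Y] (f : X ⟶ Y)
    {ι : Type u} (U : ι → X.Opens) (hU : ∀ i, IsAffineOpen (U i)) (hcov : iSup U = ⊤) :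
    (IsSemiSeparated f ↔ ∀ i j, IsAffineOpen (U i ⊓ U j)) ∧
    (IsSemiSeparatedScheme X ↔ ∀ i j, IsAffineOpen (U i ⊓ U j)) :=
  ⟨isSemiSeparated_iff_of_isOpenCover f U hcov hU,
    isSemiSeparated_iff_of_isOpenCover (terminal.from X) U hcov hU⟩
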